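/- Under weak overlap, suppose π_* is bounded away from 0 on {π^e > 0} and V* > 0. Consider the asymptotic regime of m independent copies of the stratified dataset D (total sample size n' = mn, with stratum proportions ρ_k fixed), and let Ĵ_{n'} be the average of the oracle doubly robust score φ(s,a,r;q) over all n' observations. Then √(n') (Ĵ_{n'} − J) converges in distribution, as m → ∞, to the normal distribution N(0, V*), where V* = E_{π_*}[(π^e(a|s)/π_*(a|s))² σ_r²(s,a)] + var_{p_S}[v(s)]. -/

import Mathlib

open MeasureTheory ProbabilityTheory BigOperators Filter
open scoped NNReal ENNReal Topology

noncomputable section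

/-- Joint law of an observation `(s, a, r)` when contexts are drawn from `pS`, actions
from the policy `π`, and rewards from the reward kernel `pR`. -/
def obsMeasure {S A : Type*} [MeasurableSpace S] [MeasurableSpace A] [Fintype A]
    (pS : Measure S) (π : S → A → ℝ) (pR : S → A → Measure ℝ) :
    Measure (S × A × ℝ) :=
  pS.bind fun s => ∑ a : A, ENNReal.ofReal (π s a) • (pR s a).map (fun r => (s, a, r))

lemma clt_block {C E : Type*} [Fintype C] [MeasurableSpace E] (μ : C → Measure E)
    [∀ c, IsProbabilityMeasure (μ c)] (ψ : E → ℝ) (hψ : Measurable ψ)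
    (hL : ∀ c, MemLp ψ 2 (μ c)) (h0 : ∀ c, ∫ x, ψ x ∂ μ c = 0) (n V : ℝ) (hn : 0 < n)
    (hV : 0 < V) (h2 : ∑ c, ∫ x, ψ x ^ 2 ∂ μ c = n * V) (f : BoundedContinuousFunction ℝ ℝ) :
    Tendsto (fun m : ℕ => ∫ ω, f ((√(m * n))⁻¹ * ∑ i : Fin m × C, ψ (ω i))
      ∂ Measure.pi (fun i : Fin m × C => μ i.2)) atTop
      (𝓝 (∫ x, f x ∂ gaussianReal 0 V.toNNReal)) := by
  have hT : ∀ m : ℕ, Measurable (fun ω : Fin m × C → E =>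
      (√(m * n))⁻¹ * ∑ i : Fin m × C, ψ (ω i)) := fun m => by fun_prop
  let ν : ℕ → ProbabilityMeasure ℝ := fun m =>
    ⟨(Measure.pi (fun i : Fin m × C => μ i.2)).map (fun ω =>
      (√(m * n))⁻¹ * ∑ i : Fin m × C, ψ (ω i)),
      Measure.isProbabilityMeasure_map (hT m).aemeasurable⟩
  let γ : ProbabilityMeasure ℝ := ⟨gaussianReal 0 V.toNNReal, inferInstance⟩
  have key : Tendsto ν atTop (𝓝 γ) := by
    refine ProbabilityMeasure.tendsto_iff_tendsto_charFun.2 fun t ↦ ?_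
    let P := Measure.pi μ
    let X : (C → E) → ℝ := fun ω => (√(n * V))⁻¹ * ∑ c, ψ (ω c)
    have hXm : Measurable X := by fun_prop
    have hS : (∑ c, fun ω : C → E => ψ (ω c)) = fun ω : C → E => ∑ c, ψ (ω c) := by
      ext ω; simp
    have hX0' : ∫ ω, ∑ c, ψ (ω c) ∂P = 0 := by
      rw [integral_finsetSum]
      · refine Finset.sum_eq_zero fun c _ => ?_
        rw [integral_comp_eval hψ.aestronglyMeasurable, h0]
      · intro c _
        exact integrable_comp_eval ((hL c).integrable (by norm_num))
    have hX0 : P[X] = 0 := by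
      simp only [X]
      rw [integral_const_mul, hX0', mul_zero]
    have hX1 : P[X ^ 2] = 1 := by
      simp only [X, Pi.pow_apply, mul_pow]
      rw [integral_const_mul, ← variance_of_integral_eq_zero (Measurable.aemeasurable (by fun_prop)) hX0', ← hS,
        variance_sum_pi (X := fun _ => ψ) hL]
      have : ∀ c, variance ψ (μ c) = ∫ x, ψ x ^ 2 ∂ μ c := fun c =>
        variance_of_integral_eq_zero hψ.aemeasurable (h0 c)
      simp only [this, h2]
      rw [inv_pow, Real.sq_sqrt (by positivity)]
      field_simp
    have h := tendsto_charFun_inv_sqrt_mul_pow (P := P) hXm.aemeasurable hX0 hX1 (√V * t)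
    have cf : ∀ m, charFun (ν m : Measure ℝ) t
        = (charFun (P.map X) ((√m)⁻¹ * (√V * t))) ^ m := by
      intro m
      have e1 : charFun (P.map X) ((√m)⁻¹ * (√V * t)) =
          ∏ c, charFun ((μ c).map ψ) ((√(m*n))⁻¹ * t) := by
        simp only [X]
        rw [charFun_map_mul_comp (Measurable.aemeasurable (by fun_prop)),
          (iIndepFun_pi (μ := μ) (X := fun _ => ψ)
            (fun _ => hψ.aemeasurable)).charFun_map_fun_sum_eq_prod (fun c => Measurable.aemeasurable (by fun_prop))]
        rw [Finset.prod_apply]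
        refine Finset.prod_congr rfl fun c _ => ?_
        congr 1
        · rw [← (measurePreserving_eval μ c).map_eq, Measure.map_map hψ (by fun_prop)]
          rfl
        · rw [Real.sqrt_mul hn.le, Real.sqrt_mul (by positivity)]
          have := Real.sqrt_pos.2 hV
          field_simp
      change charFun ((Measure.pi (fun i : Fin m × C => μ i.2)).map (fun ω =>
        (√(m * n))⁻¹ * ∑ i : Fin m × C, ψ (ω i))) t = _
      rw [e1, charFun_map_mul_comp (Measurable.aemeasurable (by fun_prop)),
          (iIndepFun_pi (μ := fun i : Fin m × C => μ i.2) (X := fun _ => ψ)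
            (fun _ => hψ.aemeasurable)).charFun_map_fun_sum_eq_prod (fun c => Measurable.aemeasurable (by fun_prop))]
      rw [Finset.prod_apply, Fintype.prod_prod_type]
      have : ∀ i : Fin m × C, charFun ((Measure.pi (fun i : Fin m × C => μ i.2)).map
          (fun ω => ψ (ω i))) = charFun ((μ i.2).map ψ) := by
        intro i
        rw [← (measurePreserving_eval (fun i : Fin m × C => μ i.2) i).map_eq,
          Measure.map_map hψ (by fun_prop)]
        rfl
      simp [this]
    simp only [cf]
    convert! h using 2
    change charFun (gaussianReal 0 V.toNNReal) t = _
    rw [charFun_gaussianReal]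
    congr 1
    have : ((√V : ℝ) : ℂ) ^ 2 = (V : ℂ) := by
      rw [← Complex.ofReal_pow, Real.sq_sqrt hV.le]
    push_cast
    rw [mul_pow, this, Real.coe_toNNReal _ hV.le]
    simp; ring
  have := ProbabilityMeasure.tendsto_iff_forall_integral_tendsto.1 key f
  refine this.congr fun m => ?_
  change ∫ x, f x ∂((Measure.pi (fun i : Fin m × C => μ i.2)).map (fun ω =>
      (√(m * n))⁻¹ * ∑ i : Fin m × C, ψ (ω i))) = _
  rw [integral_map (hT m).aemeasurable (by fun_prop)]

section obs

variable {S A : Type*} [MeasurableSpace S] [MeasurableSpace A] [Fintype A]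

lemma obs_meas (pR : S → A → Measure ℝ) (hRprob : ∀ s a, IsProbabilityMeasure (pR s a))
    (hRmeas : Measurable fun p : S × A => pR p.1 p.2)
    (π : S → A → ℝ) (hπ : ∀ a, Measurable fun s => π s a) :
    Measurable fun s => ∑ a : A, ENNReal.ofReal (π s a) • (pR s a).map (fun r => (s, a, r)) := by
  refine Measure.measurable_of_measurable_coe _ fun t ht => ?_
  simp only [Measure.coe_finsetSum, Finset.sum_apply, Measure.smul_apply, smul_eq_mul]
  refine Finset.measurable_sum _ fun a _ => ?_
  refine (hπ a).ennreal_ofReal.mul ?_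
  let κ : Kernel S ℝ := ⟨fun s => pR s a, hRmeas.comp (by fun_prop : Measurable fun s : S => (s, a))⟩
  have : IsMarkovKernel κ := ⟨fun s => hRprob s a⟩
  have ht' : MeasurableSet {p : S × ℝ | (p.1, a, p.2) ∈ t} :=
    (by fun_prop : Measurable fun p : S × ℝ => (p.1, a, p.2)) ht
  have := Kernel.measurable_kernel_prodMk_left (κ := κ) ht'
  convert! this using 2 with s
  rw [Measure.map_apply (by fun_prop) ht]
  rfl

lemma obs_facts (pS : Measure S) [IsProbabilityMeasure pS]
    (pR : S → A → Measure ℝ) (hRprob : ∀ s a, IsProbabilityMeasure (pR s a))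
    (hRmeas : Measurable fun p : S × A => pR p.1 p.2)
    (Rmax : ℝ) (hRbdd : ∀ s a, ∀ᵐ r ∂ pR s a, r ∈ Set.Icc (0 : ℝ) Rmax)
    (π : S → A → ℝ) (hπ : ∀ a, Measurable fun s => π s a) (hnn : ∀ s a, 0 ≤ π s a)
    (hsum : ∀ s, ∑ a, π s a = 1) :
    IsProbabilityMeasure (obsMeasure pS π pR) ∧
    (∀ᵐ x ∂ obsMeasure pS π pR, x.2.2 ∈ Set.Icc (0 : ℝ) Rmax) ∧
    ∀ (g : S × A × ℝ → ℝ) (_ : Measurable g) (B : ℝ)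
      (_ : ∀ s a r, r ∈ Set.Icc (0 : ℝ) Rmax → |g (s, a, r)| ≤ B),
      MemLp g 2 (obsMeasure pS π pR) ∧
      ∫ x, g x ∂ obsMeasure pS π pR = ∫ s, ∑ a, π s a * ∫ r, g (s, a, r) ∂ pR s a ∂ pS := by
  have hm := obs_meas pR hRprob hRmeas π hπ
  have hP : IsProbabilityMeasure (obsMeasure pS π pR) := by
    constructor
    rw [obsMeasure, Measure.bind_apply MeasurableSet.univ hm.aemeasurable]
    have : ∀ s, (∑ a : A, ENNReal.ofReal (π s a) • (pR s a).map (fun r => (s, a, r))) Set.univ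
        = 1 := by
      intro s
      simp only [Measure.coe_finsetSum, Finset.sum_apply, Measure.smul_apply, smul_eq_mul]
      have : ∀ a, (pR s a).map (fun r => (s, a, r)) Set.univ = 1 := by
        intro a
        rw [Measure.map_apply (by fun_prop) MeasurableSet.univ]
        simp
      simp only [this, mul_one]
      rw [← ENNReal.ofReal_sum_of_nonneg (fun a _ => hnn s a), hsum, ENNReal.ofReal_one]
    simp [this]
  have hae : ∀ᵐ x ∂ obsMeasure pS π pR, x.2.2 ∈ Set.Icc (0 : ℝ) Rmax := by
    have hs : MeasurableSet {x : S × A × ℝ | ¬ x.2.2 ∈ Set.Icc (0 : ℝ) Rmax} :=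
      ((by fun_prop : Measurable fun x : S × A × ℝ => x.2.2) measurableSet_Icc).compl
    rw [ae_iff, obsMeasure, Measure.bind_apply hs hm.aemeasurable]
    have : ∀ s, (∑ a : A, ENNReal.ofReal (π s a) • (pR s a).map (fun r => (s, a, r)))
        {x : S × A × ℝ | ¬ x.2.2 ∈ Set.Icc (0 : ℝ) Rmax} = 0 := by
      intro s
      simp only [Measure.coe_finsetSum, Finset.sum_apply, Measure.smul_apply, smul_eq_mul]
      refine Finset.sum_eq_zero fun a _ => ?_
      rw [Measure.map_apply (by fun_prop) hs]
      have := ae_iff.1 (hRbdd s a)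
      simp only [Set.preimage_ofPred_eq, this, mul_zero]
    simp only [this, lintegral_zero]
  refine ⟨hP, hae, fun g hg B hB => ?_⟩
  have hbd : ∀ᵐ x ∂ obsMeasure pS π pR, ‖g x‖ ≤ B := by
    filter_upwards [hae] with x hx
    exact hB _ _ _ hx
  have hL := MemLp.of_bound (p := 2) hg.aestronglyMeasurable B hbd
  refine ⟨hL, ?_⟩
  have hint := hL.integrable (by norm_num)
  let κ : Kernel S (S × A × ℝ) := ⟨_, hm⟩
  have e : obsMeasure pS π pR = (κ ∘ₖ Kernel.const Unit pS) () := by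
    rw [Kernel.comp_apply, Kernel.const_apply]; rfl
  rw [e] at hint ⊢
  rw [Kernel.integral_comp hint, Kernel.const_apply]
  refine integral_congr_ae (Eventually.of_forall fun s => ?_)
  change ∫ y, g y ∂(∑ a : A, ENNReal.ofReal (π s a) • (pR s a).map (fun r => (s, a, r))) = _
  rw [integral_finsetSum_measure]
  · refine Finset.sum_congr rfl fun a _ => ?_
    rw [integral_smul_measure, integral_map (by fun_prop) hg.aestronglyMeasurable,
      ENNReal.toReal_ofReal (hnn s a), smul_eq_mul]
  · intro a _
    refine Integrable.smul_measure ?_ ENNReal.ofReal_ne_top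
    rw [integrable_map_measure hg.aestronglyMeasurable (by fun_prop)]
    refine Integrable.of_bound (hg.comp (by fun_prop)).aestronglyMeasurable B ?_
    filter_upwards [hRbdd s a] with r hr
    exact hB _ _ _ hr

end obs

/-- Under weak overlap, with `π_*` bounded away from `0` on
`{π^e > 0}` and `V* > 0`, consider the asymptotic regime of `m` independent copies of
the stratified dataset `D` (total sample size `n' = m n`, stratum proportions fixed),
and let `Ĵ_{n'}` be the average of the oracle doubly robust score `φ(s,a,r;q)` over
all `n'` observations.  Then `√(n') (Ĵ_{n'} − J)` converges in distribution (tested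
against all bounded continuous functions) to `N(0, V*)`, where
`V* = E_{π_*}[(π^e/π_*)² σ_r²(s,a)] + var_{p_S}[v(s)]`. -/
theorem stmt17 {S A : Type*} [MeasurableSpace S] [MeasurableSpace A] [Fintype A]
    [MeasurableSingletonClass A]
    (K : ℕ) (pS : Measure S) [IsProbabilityMeasure pS]
    (pR : S → A → Measure ℝ) (hRprob : ∀ s a, IsProbabilityMeasure (pR s a))
    (hRmeas : Measurable fun p : S × A => pR p.1 p.2)
    (Rmax : ℝ) (hRbdd : ∀ s a, ∀ᵐ r ∂ pR s a, r ∈ Set.Icc (0 : ℝ) Rmax)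
    (πk : Fin K → S → A → ℝ) (πe : S → A → ℝ)
    (hπkmeas : ∀ k a, Measurable fun s => πk k s a)
    (hπemeas : ∀ a, Measurable fun s => πe s a)
    (hπknn : ∀ k s a, 0 ≤ πk k s a) (hπksum : ∀ k s, ∑ a, πk k s a = 1)
    (hπenn : ∀ s a, 0 ≤ πe s a) (hπesum : ∀ s, ∑ a, πe s a = 1)
    -- stratum sizes and proportions
    (nk : Fin K → ℕ) (hn : 0 < ∑ k, nk k)
    (ρ : Fin K → ℝ) (hρ : ∀ k, ρ k = (nk k : ℝ) / (∑ k, nk k : ℕ))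
    -- marginal logging policy
    (πstar : S → A → ℝ) (hπstar : ∀ s a, πstar s a = ∑ k, ρ k * πk k s a)
    -- weak overlap, with `π_*` bounded away from zero on `{π^e > 0}`
    (hov : ∀ s a, 0 < πe s a → 0 < πstar s a)
    (δ : ℝ) (hδ : 0 < δ) (hπstarlb : ∀ s a, 0 < πe s a → δ ≤ πstar s a)
    -- true mean reward, conditional reward variance, value function, policy value
    (q : S → A → ℝ) (hq : ∀ s a, q s a = ∫ r, r ∂ pR s a)
    (σ2 : S → A → ℝ) (hσ2 : ∀ s a, σ2 s a = variance id (pR s a))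
    (v : S → ℝ) (hv : ∀ s, v s = ∑ a, πe s a * q s a)
    (J : ℝ) (hJ : J = ∫ s, v s ∂ pS)
    -- the efficiency bound `V*`, assumed positive
    (Vstar : ℝ)
    (hVstar : Vstar =
      (∫ x : S × A × ℝ,
          (if πe x.1 x.2.1 = 0 then 0 else πe x.1 x.2.1 / πstar x.1 x.2.1) ^ 2 *
            σ2 x.1 x.2.1
        ∂ obsMeasure pS πstar pR) + variance v pS)
    (hVpos : 0 < Vstar)
    -- the oracle doubly robust score `φ(s,a,r;q)`
    (φ : S × A × ℝ → ℝ)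
    (hφ : ∀ x : S × A × ℝ, φ x =
      (if πe x.1 x.2.1 = 0 then 0 else πe x.1 x.2.1 / πstar x.1 x.2.1) *
        (x.2.2 - q x.1 x.2.1) + ∑ a, πe x.1 a * q x.1 a)
    -- the oracle doubly robust estimator on `m` independent copies of `D`
    (Jhat : (m : ℕ) → ((Fin m × ((k : Fin K) × Fin (nk k))) → S × A × ℝ) → ℝ)
    (hJhat : ∀ m ω, Jhat m ω =
      ((m * ∑ k, nk k : ℕ) : ℝ)⁻¹ * ∑ i : Fin m × ((k : Fin K) × Fin (nk k)), φ (ω i)) :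
    -- convergence in distribution to `N(0, V*)`
    ∀ f : BoundedContinuousFunction ℝ ℝ,
      Tendsto (fun m : ℕ =>
          ∫ ω, f (Real.sqrt ((m * ∑ k, nk k : ℕ) : ℝ) * (Jhat m ω - J))
            ∂ Measure.pi
                (fun i : Fin m × ((k : Fin K) × Fin (nk k)) => obsMeasure pS (πk i.2.1) pR))
        atTop
        (𝓝 (∫ x, f x ∂ gaussianReal 0 Vstar.toNNReal)) := by
  have hcont : ∀ s a, ‖q s a‖ ≤ |Rmax| := by
    intro s a
    have := norm_integral_le_of_norm_le_const (μ := pR s a) (f := fun r => r) (C := |Rmax|) (by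
      filter_upwards [hRbdd s a] with r hr
      rw [Real.norm_eq_abs, abs_of_nonneg hr.1]
      exact hr.2.trans (le_abs_self _))
    simpa [hq] using this
  let κ : Kernel (S × A) ℝ := ⟨fun p : S × A => pR p.1 p.2, hRmeas⟩
  have : IsMarkovKernel κ := ⟨fun p => hRprob p.1 p.2⟩
  have hqm : Measurable fun p : S × A => q p.1 p.2 := by
    have h : StronglyMeasurable fun p : S × A => ∫ r, r ∂ κ p :=
      stronglyMeasurable_id.integral_kernel
    simp only [hq]
    exact h.measurable
  have hσ2' : ∀ s a, σ2 s a = ∫ r, (r - q s a) ^ 2 ∂ pR s a := by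
    intro s a
    rw [hσ2, variance_eq_integral aemeasurable_id, hq]
    rfl
  have hσm : Measurable fun p : S × A => σ2 p.1 p.2 := by
    have h : StronglyMeasurable fun p : S × A => ∫ r, (r - q p.1 p.2) ^ 2 ∂ κ p := by
      apply StronglyMeasurable.integral_kernel_prod_right
      apply Measurable.stronglyMeasurable
      have := hqm.comp (measurable_fst : Measurable (Prod.fst : (S × A) × ℝ → S × A))
      exact (measurable_snd.sub this).pow_const 2
    simp only [hσ2']
    exact h.measurable
  have hπem : Measurable fun p : S × A => πe p.1 p.2 :=
    measurable_from_prod_countable_left hπemeas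
  have hπsm' : ∀ a, Measurable fun s => πstar s a := by
    intro a
    simp only [hπstar]
    have := hπkmeas
    fun_prop
  have hπsm : Measurable fun p : S × A => πstar p.1 p.2 :=
    measurable_from_prod_countable_left hπsm'
  obtain ⟨w, hw⟩ : ∃ w : S → A → ℝ, w = fun s a =>
    if πe s a = 0 then 0 else πe s a / πstar s a := ⟨_, rfl⟩
  have hw' : ∀ s a, (if πe s a = 0 then 0 else πe s a / πstar s a) = w s a := by
    intro s a; rw [hw]
  simp only [hw'] at hφ hVstar
  have hwm : Measurable fun p : S × A => w p.1 p.2 := by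
    rw [hw]
    exact Measurable.ite (hπem (measurableSet_singleton 0)) measurable_const (hπem.div hπsm)
  have hwb : ∀ s a, |w s a| ≤ δ⁻¹ := by
    intro s a
    rw [hw]
    dsimp only
    split_ifs with h
    · simp [hδ.le]
    · have h1 : 0 < πe s a := lt_of_le_of_ne (hπenn s a) (Ne.symm h)
      have h2 := hπstarlb s a h1
      have h3 : πe s a ≤ 1 := by
        rw [← hπesum s]
        exact Finset.single_le_sum (fun a _ => hπenn s a) (Finset.mem_univ a)
      rw [abs_of_nonneg (div_nonneg h1.le (hδ.le.trans h2)), ← one_div]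
      exact div_le_div₀ zero_le_one h3 hδ h2
  have hvm : Measurable v := by
    have : v = fun s => ∑ a, πe s a * q s a := funext hv
    rw [this]
    refine Finset.measurable_sum _ fun a _ => (hπemeas a).mul ?_
    exact hqm.comp (by fun_prop : Measurable fun s : S => (s, a))
  have hvb : ∀ s, |v s| ≤ |Rmax| := by
    intro s
    rw [hv]
    refine (Finset.abs_sum_le_sum_abs _ _).trans ?_
    calc ∑ a, |πe s a * q s a| ≤ ∑ a, πe s a * |Rmax| := by
          refine Finset.sum_le_sum fun a _ => ?_
          rw [abs_mul, abs_of_nonneg (hπenn s a)]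
          exact mul_le_mul_of_nonneg_left (hcont s a) (hπenn s a)
      _ = |Rmax| := by rw [← Finset.sum_mul, hπesum, one_mul]
  have hφ' : ∀ s a r, φ (s, a, r) = w s a * (r - q s a) + v s := by
    intro s a r; rw [hφ, hv]
  have hφm : Measurable φ := by
    have : φ = fun x => w x.1 x.2.1 * (x.2.2 - q x.1 x.2.1) + v x.1 := by
      ext ⟨s, a, r⟩; exact hφ' s a r
    rw [this]
    have hp : Measurable fun x : S × A × ℝ => (x.1, x.2.1) := by fun_prop
    have h1 := hwm.comp hp
    have h2 := hqm.comp hp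
    exact (h1.mul ((by fun_prop : Measurable fun x : S × A × ℝ => x.2.2).sub h2)).add
      (hvm.comp measurable_fst)
  let ψ : S × A × ℝ → ℝ := fun x => φ x - J
  have hψm : Measurable ψ := hφm.sub_const J
  have hrq : ∀ s a r, r ∈ Set.Icc (0 : ℝ) Rmax → |r - q s a| ≤ 2 * |Rmax| := by
    intro s a r hr
    have h1 : |r| ≤ |Rmax| := by
      rw [abs_of_nonneg hr.1]; exact hr.2.trans (le_abs_self _)
    have h2 := hcont s a
    rw [Real.norm_eq_abs] at h2
    have := abs_sub r (q s a)
    linarith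
  obtain ⟨B, hBdef⟩ : ∃ B : ℝ, B = δ⁻¹ * (2 * |Rmax|) + |Rmax| + |J| := ⟨_, rfl⟩
  have hψb : ∀ s a r, r ∈ Set.Icc (0 : ℝ) Rmax → |ψ (s, a, r)| ≤ B := by
    intro s a r hr
    have h1 : |w s a * (r - q s a)| ≤ δ⁻¹ * (2 * |Rmax|) := by
      rw [abs_mul]
      exact mul_le_mul (hwb s a) (hrq s a r hr) (abs_nonneg _) (by positivity)
    have h2 := hvb s
    simp only [ψ, hφ', hBdef]
    calc _ ≤ |w s a * (r - q s a) + v s| + |J| := abs_sub _ _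
      _ ≤ |w s a * (r - q s a)| + |v s| + |J| := by gcongr; exact abs_add_le _ _
      _ ≤ _ := by gcongr
  have hψ2b : ∀ s a r, r ∈ Set.Icc (0 : ℝ) Rmax → |(fun x => ψ x ^ 2) (s, a, r)| ≤ B ^ 2 := by
    intro s a r hr
    simp only [abs_pow]
    exact pow_le_pow_left₀ (abs_nonneg _) (hψb s a r hr) 2
  have hi1 : ∀ s a, Integrable (fun r => r - q s a) (pR s a) := by
    intro s a
    refine Integrable.of_bound (by fun_prop) (2 * |Rmax|) ?_
    filter_upwards [hRbdd s a] with r hr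
    exact hrq s a r hr
  have hi2 : ∀ s a, Integrable (fun r => (r - q s a) ^ 2) (pR s a) := by
    intro s a
    refine Integrable.of_bound (by fun_prop) ((2 * |Rmax|) ^ 2) ?_
    filter_upwards [hRbdd s a] with r hr
    rw [Real.norm_eq_abs, abs_pow]
    exact pow_le_pow_left₀ (abs_nonneg _) (hrq s a r hr) 2
  have hiid : ∀ s a, Integrable (fun r : ℝ => r) (pR s a) := by
    intro s a
    refine ((hi1 s a).add (integrable_const (q s a))).congr (Eventually.of_forall fun r => ?_)
    simp
  have hm1 : ∀ s a, ∫ r, (r - q s a) ∂ pR s a = 0 := by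
    intro s a
    rw [integral_sub (hiid s a) (integrable_const _), ← hq]
    simp
  have hc1 : ∀ s a, ∫ r, ψ (s, a, r) ∂ pR s a = v s - J := by
    intro s a
    have : ∀ r, ψ (s, a, r) = w s a * (r - q s a) + (v s - J) := by
      intro r; simp only [ψ, hφ']; ring
    simp only [this]
    rw [integral_add ((hi1 s a).const_mul _) (integrable_const _), integral_const_mul, hm1]
    simp
  have hc2 : ∀ s a, ∫ r, ψ (s, a, r) ^ 2 ∂ pR s a = w s a ^ 2 * σ2 s a + (v s - J) ^ 2 := by
    intro s a
    have : ∀ r, ψ (s, a, r) ^ 2 = w s a ^ 2 * (r - q s a) ^ 2 +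
        (2 * w s a * (v s - J)) * (r - q s a) + (v s - J) ^ 2 := by
      intro r; simp only [ψ, hφ']; ring
    simp only [this]
    have hi3 : Integrable (fun r => w s a ^ 2 * (r - q s a) ^ 2 +
        (2 * w s a * (v s - J)) * (r - q s a)) (pR s a) :=
      ((hi2 s a).const_mul _).add ((hi1 s a).const_mul _)
    rw [integral_add hi3 (integrable_const _),
      integral_add ((hi2 s a).const_mul _) ((hi1 s a).const_mul _),
      integral_const_mul, integral_const_mul, hm1, hσ2']
    simp
  have hσb : ∀ s a, |σ2 s a| ≤ (2 * |Rmax|) ^ 2 := by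
    intro s a
    rw [hσ2', ← Real.norm_eq_abs]
    have := norm_integral_le_of_norm_le_const (μ := pR s a) (f := fun r => (r - q s a) ^ 2)
      (C := (2 * |Rmax|) ^ 2) (by
        filter_upwards [hRbdd s a] with r hr
        rw [Real.norm_eq_abs, abs_pow]
        exact pow_le_pow_left₀ (abs_nonneg _) (hrq s a r hr) 2)
    simpa using this
  have hwσb : ∀ s a, |w s a ^ 2 * σ2 s a| ≤ δ⁻¹ ^ 2 * (2 * |Rmax|) ^ 2 := by
    intro s a
    rw [abs_mul, abs_pow]
    exact mul_le_mul (pow_le_pow_left₀ (abs_nonneg _) (hwb s a) 2) (hσb s a) (abs_nonneg _)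
      (by positivity)
  have hwσm : Measurable fun p : S × A => w p.1 p.2 ^ 2 * σ2 p.1 p.2 := (hwm.pow_const 2).mul hσm
  have hvi : Integrable v pS :=
    Integrable.of_bound hvm.aestronglyMeasurable |Rmax| (Eventually.of_forall hvb)
  have hvi2 : Integrable (fun s => (v s - J) ^ 2) pS := by
    refine Integrable.of_bound (by fun_prop) ((|Rmax| + |J|) ^ 2) (Eventually.of_forall fun s => ?_)
    rw [Real.norm_eq_abs, abs_pow]
    refine pow_le_pow_left₀ (abs_nonneg _) ?_ 2
    exact (abs_sub _ _).trans (add_le_add_left (hvb s) _)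
  have hvar : variance v pS = ∫ s, (v s - J) ^ 2 ∂ pS := by
    rw [variance_eq_integral hvm.aemeasurable, hJ]
  -- normalisation
  have hNpos : (0 : ℝ) < ((∑ k, nk k : ℕ) : ℝ) := by exact_mod_cast hn
  have hρnn : ∀ k, 0 ≤ ρ k := fun k => by rw [hρ]; positivity
  have hρsum : ∑ k, ρ k = 1 := by
    simp only [hρ]
    rw [← Finset.sum_div, ← Nat.cast_sum, div_self hNpos.ne']
  have hπsnn : ∀ s a, 0 ≤ πstar s a := fun s a => by
    rw [hπstar]; exact Finset.sum_nonneg fun k _ => mul_nonneg (hρnn k) (hπknn k s a)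
  have hπssum : ∀ s, ∑ a, πstar s a = 1 := fun s => by
    simp only [hπstar]
    rw [Finset.sum_comm]
    simp only [← Finset.mul_sum, hπksum, mul_one, hρsum]
  have F := fun k => obs_facts pS pR hRprob hRmeas Rmax hRbdd (πk k) (hπkmeas k) (hπknn k)
    (hπksum k)
  have Fs := obs_facts pS pR hRprob hRmeas Rmax hRbdd πstar hπsm' hπsnn hπssum
  have hGi : ∀ k, Integrable (fun s => ∑ a, πk k s a * (w s a ^ 2 * σ2 s a)) pS := by
    intro k
    refine integrable_finsetSum _ fun a _ => ?_
    refine Integrable.of_bound ?_ (1 * (δ⁻¹ ^ 2 * (2 * |Rmax|) ^ 2))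
      (Eventually.of_forall fun s => ?_)
    · exact ((hπkmeas k a).mul
        (hwσm.comp (by fun_prop : Measurable fun s : S => (s, a)))).aestronglyMeasurable
    · rw [Real.norm_eq_abs, abs_mul, abs_of_nonneg (hπknn k s a)]
      refine mul_le_mul ?_ (hwσb s a) (abs_nonneg _) zero_le_one
      rw [← hπksum k s]
      exact Finset.single_le_sum (fun a _ => hπknn k s a) (Finset.mem_univ a)
  have hk2 : ∀ k, ∫ x, ψ x ^ 2 ∂ obsMeasure pS (πk k) pR =
      ∫ s, ∑ a, πk k s a * (w s a ^ 2 * σ2 s a) ∂ pS + variance v pS := by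
    intro k
    rw [((F k).2.2 (fun x => ψ x ^ 2) (hψm.pow_const 2) (B ^ 2) hψ2b).2, hvar,
      ← integral_add (hGi k) hvi2]
    refine integral_congr_ae (Eventually.of_forall fun s => ?_)
    simp only [hc2, mul_add, Finset.sum_add_distrib]
    rw [← Finset.sum_mul, hπksum, one_mul]
  have hk1 : ∀ k, ∫ x, ψ x ∂ obsMeasure pS (πk k) pR = 0 := by
    intro k
    rw [((F k).2.2 ψ hψm B hψb).2]
    simp only [hc1]
    simp only [← Finset.sum_mul, hπksum, one_mul]
    rw [integral_sub hvi (integrable_const _), hJ]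
    simp
  have hVs : Vstar = ∑ k, ρ k * ∫ s, ∑ a, πk k s a * (w s a ^ 2 * σ2 s a) ∂ pS
      + variance v pS := by
    rw [hVstar]
    congr 1
    rw [(Fs.2.2 (fun x => w x.1 x.2.1 ^ 2 * σ2 x.1 x.2.1)
      (hwσm.comp (by fun_prop : Measurable fun x : S × A × ℝ => (x.1, x.2.1))) _
      (fun s a r _ => hwσb s a)).2]
    simp only [← integral_const_mul]
    rw [← integral_finsetSum _ fun k _ => (hGi k).const_mul _]
    refine integral_congr_ae (Eventually.of_forall fun s => ?_)
    simp only [integral_const, probReal_univ, one_smul, hπstar, Finset.sum_mul, Finset.mul_sum]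
    rw [Finset.sum_comm]
    refine Finset.sum_congr rfl fun k _ => Finset.sum_congr rfl fun a _ => ?_
    ring
  intro f
  have : ∀ c : (k : Fin K) × Fin (nk k), IsProbabilityMeasure (obsMeasure pS (πk c.1) pR) :=
    fun c => (F c.1).1
  have main := clt_block (fun c : (k : Fin K) × Fin (nk k) => obsMeasure pS (πk c.1) pR) ψ hψm
    (fun c => ((F c.1).2.2 ψ hψm B hψb).1) (fun c => hk1 c.1)
    ((∑ k, nk k : ℕ) : ℝ) Vstar hNpos hVpos (by
      rw [Fintype.sum_sigma]
      simp only [hk2, Finset.sum_const, Finset.card_univ, Fintype.card_fin, nsmul_eq_mul, mul_add,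
        Finset.sum_add_distrib]
      rw [hVs, mul_add, Finset.mul_sum, ← Finset.sum_mul, ← Nat.cast_sum]
      congr 1
      refine Finset.sum_congr rfl fun k _ => ?_
      rw [hρ, ← mul_assoc, mul_div_cancel₀ _ hNpos.ne']) f
  refine main.congr fun m => ?_
  refine integral_congr_ae (Eventually.of_forall fun ω => ?_)
  dsimp only
  congr 1
  rw [hJhat, Nat.cast_mul]
  simp only [ψ, Finset.sum_sub_distrib, Finset.sum_const, Finset.card_univ, Fintype.card_prod,
    Fintype.card_fin, Fintype.card_sigma, nsmul_eq_mul]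
  rw [Nat.cast_mul]
  obtain h | h := eq_or_ne ((m : ℝ) * ((∑ k, nk k : ℕ) : ℝ)) 0
  · rw [h]; simp
  · have hp : 0 < (m : ℝ) * ((∑ k, nk k : ℕ) : ℝ) := lt_of_le_of_ne (by positivity) (Ne.symm h)
    generalize (m : ℝ) * ((∑ k, nk k : ℕ) : ℝ) = M at *
    have hs := Real.sq_sqrt hp.le
    have hsp := Real.sqrt_pos.2 hp
    rw [inv_mul_eq_iff_eq_mul₀ hsp.ne', ← mul_assoc, ← pow_two, hs, mul_sub,
      mul_inv_cancel_left₀ h]
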